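/- Let P be a full-support joint distribution on Ω and let C_1, …, C_r, F_i, R_i, Q be as in the chain junction construction. Then Q is a joint distribution on Ω: Q(x) ≥ 0 for all x and Σ_{x ∈ Ω} Q(x) = 1. Moreover, the marginal of Q on C_1 equals the marginal of P on C_1: Q_{C_1} = P_{C_1}. -/

import Mathlib

open scoped BigOperators

namespace CausalPre

variable {ι : Type*} [Fintype ι] [DecidableEq ι]
variable {F : ι → Type*} [∀ i, Fintype (F i)] [∀ i, DecidableEq (F i)]
  [∀ i, Nonempty (F i)]

/-- Restriction of a full configuration to the coordinates in `S`. -/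
def restrict (S : Finset ι) (x : ∀ i, F i) : ∀ i : S, F i := fun i => x i

/-- `P` is a joint distribution on `Ω = Π i, F i`. -/
def IsJoint (P : (∀ i, F i) → ℝ) : Prop :=
  (∀ x, 0 ≤ P x) ∧ ∑ x, P x = 1

/-- `P` has full support. -/
def FullSupport (P : (∀ i, F i) → ℝ) : Prop := ∀ x, 0 < P x

/-- Marginal of `P` on the coordinates in `S`. -/
noncomputable def marginal (P : (∀ i, F i) → ℝ) (S : Finset ι)
    (s : ∀ i : S, F i) : ℝ :=
  ∑ x : ∀ i, F i, if restrict S x = s then P x else 0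

/-- Conditional probability `P[T | S]`, evaluated at the restrictions of a full
configuration `x`:  `P[T | S](x_T | x_S) = P_{S ∪ T}(x_{S ∪ T}) / P_S(x_S)`. -/
noncomputable def condProb (P : (∀ i, F i) → ℝ) (T S : Finset ι)
    (x : ∀ i, F i) : ℝ :=
  marginal P (S ∪ T) (restrict (S ∪ T) x) / marginal P S (restrict S x)

/-- Entropy of the marginal of `P` on `S`. -/
noncomputable def entropy (P : (∀ i, F i) → ℝ) (S : Finset ι) : ℝ :=
  -∑ s : ∀ i : S, F i, marginal P S s * Real.log (marginal P S s)

/-- Mutual information `I(S ; T)` of disjoint `S`, `T`. -/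
noncomputable def mutualInfo (P : (∀ i, F i) → ℝ) (S T : Finset ι) : ℝ :=
  entropy P S + entropy P T - entropy P (S ∪ T)

/-- Conditional entropy `H(S | T)` for disjoint `S`, `T`. -/
noncomputable def condEntropy (P : (∀ i, F i) → ℝ) (S T : Finset ι) : ℝ :=
  entropy P (S ∪ T) - entropy P T

/-- Conditional mutual information `I(S ; T | U)` of pairwise disjoint `S`, `T`, `U`. -/
noncomputable def condMutualInfo (P : (∀ i, F i) → ℝ) (S T U : Finset ι) : ℝ :=
  entropy P (S ∪ U) + entropy P (T ∪ U) - entropy P (S ∪ T ∪ U) - entropy P U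

/-- Kullback–Leibler divergence `D_KL(P ‖ Q) = Σ_{x : P(x) > 0} P(x) log (P(x)/Q(x))`. -/
noncomputable def klDiv (P Q : (∀ i, F i) → ℝ) : ℝ :=
  ∑ x, if 0 < P x then P x * Real.log (P x / Q x) else 0

variable {r : ℕ}

/-- Union of the preceding cliques: `C_0 ∪ … ∪ C_{i-1}`. -/
def prevUnion (C : Fin (r + 1) → Finset ι) (i : Fin (r + 1)) : Finset ι :=
  (Finset.univ.filter (fun j => j < i)).sup C

/-- Separator `F_i = C_i ∩ (C_0 ∪ … ∪ C_{i-1})`. -/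
def sepSet (C : Fin (r + 1) → Finset ι) (i : Fin (r + 1)) : Finset ι :=
  C i ∩ prevUnion C i

/-- Residual `R_i = C_i \ F_i`. -/
def resSet (C : Fin (r + 1) → Finset ι) (i : Fin (r + 1)) : Finset ι :=
  C i \ sepSet C i

/-- The chain junction factorization
`Q(x) = P_{C_0}(x_{C_0}) · Π_{i ≠ 0} P[R_i | F_i](x_{R_i} | x_{F_i})`. -/
noncomputable def chainQ (P : (∀ i, F i) → ℝ) (C : Fin (r + 1) → Finset ι)
    (x : ∀ i, F i) : ℝ :=
  marginal P (C 0) (restrict (C 0) x) *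
    ∏ i ∈ Finset.univ.filter (fun j : Fin (r + 1) => j ≠ 0),
      condProb P (resSet C i) (sepSet C i) x

set_option linter.unusedSectionVars false

theorem restrict_eq_restrict_iff {S : Finset ι} {x y : ∀ i, F i} :
    restrict S x = restrict S y ↔ ∀ i ∈ S, x i = y i := by
  simp [restrict, funext_iff]

theorem exists_restrict_eq (S : Finset ι) (s : ∀ i : S, F i) :
    ∃ x : ∀ i, F i, restrict S x = s := by
  classical
  refine ⟨fun i => if h : i ∈ S then s ⟨i, h⟩ else Classical.arbitrary _, ?_⟩
  ext i
  simp [restrict]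

theorem sum_marginal (P : (∀ i, F i) → ℝ) (S : Finset ι) :
    ∑ s, marginal P S s = ∑ x, P x := by
  unfold marginal
  rw [Finset.sum_comm]
  simp

theorem marginal_nonneg {P : (∀ i, F i) → ℝ} (hP : ∀ x, 0 ≤ P x) (S : Finset ι)
    (s : ∀ i : S, F i) : 0 ≤ marginal P S s :=
  Finset.sum_nonneg fun x _ => by split_ifs <;> simp [hP x]

theorem marginal_restrict_pos {P : (∀ i, F i) → ℝ} (hP : FullSupport P) (S : Finset ι)
    (x : ∀ i, F i) : 0 < marginal P S (restrict S x) := by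
  refine Finset.sum_pos' (fun y _ => ?_) ⟨x, Finset.mem_univ x, ?_⟩
  · split_ifs
    exacts [(hP y).le, le_rfl]
  · simpa using hP x

theorem condProb_congr (P : (∀ i, F i) → ℝ) {S T : Finset ι} {x y : ∀ i, F i}
    (h : ∀ i ∈ S ∪ T, x i = y i) : condProb P T S x = condProb P T S y := by
  unfold condProb
  rw [restrict_eq_restrict_iff.2 h,
    restrict_eq_restrict_iff.2 fun i hi => h i (Finset.mem_union_left _ hi)]

/-- Summing the marginal on `S ∪ T` over the coordinates in `T` gives the marginal on `S`. -/
theorem sum_marginal_union (P : (∀ i, F i) → ℝ) {S T : Finset ι} (hST : Disjoint S T)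
    (y : ∀ i, F i) :
    (∑ x : ∀ i, F i, if restrict Tᶜ x = restrict Tᶜ y
      then marginal P (S ∪ T) (restrict (S ∪ T) x) else 0) = marginal P S (restrict S y) := by
  have key : ∀ x z : ∀ i, F i, (restrict Tᶜ x = restrict Tᶜ y ∧
      restrict (S ∪ T) z = restrict (S ∪ T) x) ↔
      x = T.piecewise z y ∧ restrict S z = restrict S y := by
    intro x z
    simp only [restrict_eq_restrict_iff, Finset.mem_compl, Finset.mem_union]
    simp only [funext_iff, Finset.piecewise]
    have := Finset.disjoint_left.1 hST
    grind
  calc _ = ∑ x : ∀ i, F i, ∑ z, if restrict Tᶜ x = restrict Tᶜ y ∧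
          restrict (S ∪ T) z = restrict (S ∪ T) x then P z else 0 := by
        refine Finset.sum_congr rfl fun x _ => ?_
        by_cases h : restrict Tᶜ x = restrict Tᶜ y <;> simp [h, marginal]
    _ = ∑ z, ∑ x : ∀ i, F i, if x = T.piecewise z y ∧ restrict S z = restrict S y
          then P z else 0 := by
        rw [Finset.sum_comm]
        simp only [key]
    _ = _ := by simp [ite_and, marginal]

/-- Conditional probabilities of `T` given `S` sum to one over the coordinates in `T`. -/
theorem sum_condProb {P : (∀ i, F i) → ℝ} (hP : FullSupport P) {S T : Finset ι}
    (hST : Disjoint S T) (y : ∀ i, F i) :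
    (∑ x : ∀ i, F i, if restrict Tᶜ x = restrict Tᶜ y then condProb P T S x else 0) = 1 := by
  rw [← div_self (marginal_restrict_pos hP S y).ne']
  nth_rw 1 [← sum_marginal_union P hST y]
  rw [Finset.sum_div]
  refine Finset.sum_congr rfl fun x _ => ?_
  split_ifs with h
  · have hS : restrict S x = restrict S y := restrict_eq_restrict_iff.2 fun i hi =>
      restrict_eq_restrict_iff.1 h i (Finset.mem_compl.2 (Finset.disjoint_left.1 hST hi))
    rw [condProb, hS]
  · simp

/-- Against a function that does not depend on the coordinates in `T`, the conditional
probability of `T` given `S` has the same sum as the point mass at `a` on `T`. -/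
theorem sum_mul_condProb {P : (∀ i, F i) → ℝ} (hP : FullSupport P) {S T : Finset ι}
    (hST : Disjoint S T) (a : ∀ i, F i) {g : (∀ i, F i) → ℝ}
    (hg : ∀ x y, restrict Tᶜ x = restrict Tᶜ y → g x = g y) :
    ∑ x, g x * condProb P T S x = ∑ x, g x * if restrict T x = restrict T a then 1 else 0 := by
  have key : ∀ x y : ∀ i, F i, y = T.piecewise a x ↔
      restrict T y = restrict T a ∧ restrict Tᶜ x = restrict Tᶜ y := by
    intro x y
    simp only [restrict_eq_restrict_iff, Finset.mem_compl]
    simp only [funext_iff, Finset.piecewise]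
    grind
  calc ∑ x, g x * condProb P T S x
      = ∑ x, ∑ y, if y = T.piecewise a x then g x * condProb P T S x else 0 := by simp
    _ = ∑ y, ∑ x, if y = T.piecewise a x then g x * condProb P T S x else 0 :=
        Finset.sum_comm
    _ = ∑ y, (g y * if restrict T y = restrict T a then 1 else 0) *
          ∑ x, if restrict Tᶜ x = restrict Tᶜ y then condProb P T S x else 0 := by
        refine Finset.sum_congr rfl fun y _ => ?_
        rw [Finset.mul_sum]
        refine Finset.sum_congr rfl fun x _ => ?_
        simp only [key]
        by_cases h : restrict Tᶜ x = restrict Tᶜ y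
        · simp [h, hg x y h]
        · simp [h]
    _ = _ := by simp [sum_condProb hP hST]

/-- A product of conditional probabilities, each of whose targets is disjoint from everything
occurring in the earlier factors, can be replaced under a sum by point masses at `a`. -/
theorem sum_mul_prod_condProb {α : Type*} [LinearOrder α] {P : (∀ i, F i) → ℝ}
    (hP : FullSupport P) {S T : α → Finset ι} (hST : ∀ i, Disjoint (S i) (T i))
    (hlt : ∀ i j, i < j → Disjoint (S i ∪ T i) (T j)) (a : ∀ i, F i) (J : Finset α)
    (h : (∀ i, F i) → ℝ)
    (hh : ∀ j ∈ J, ∀ x y, restrict (T j)ᶜ x = restrict (T j)ᶜ y → h x = h y) :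
    ∑ x, h x * ∏ j ∈ J, condProb P (T j) (S j) x =
      ∑ x, h x * ∏ j ∈ J, if restrict (T j) x = restrict (T j) a then 1 else 0 := by
  induction J using Finset.induction_on_max generalizing h with
  | empty => simp
  | insert m J hm ih =>
    have hmJ : m ∉ J := fun hmem => lt_irrefl m (hm m hmem)
    simp_rw [Finset.prod_insert hmJ]
    have hstep := sum_mul_condProb hP (hST m) a
      (g := fun x => h x * ∏ j ∈ J, condProb P (T j) (S j) x) fun x y hxy => by
        rw [hh m (Finset.mem_insert_self m J) x y hxy]
        congr 1
        refine Finset.prod_congr rfl fun j hj => condProb_congr P fun i hi => ?_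
        exact restrict_eq_restrict_iff.1 hxy i
          (Finset.mem_compl.2 (Finset.disjoint_left.1 (hlt j m (hm j hj)) hi))
    have hrec := ih (fun x => h x * if restrict (T m) x = restrict (T m) a then 1 else 0)
      fun j hj x y hxy => by
        have hres : restrict (T m) x = restrict (T m) y :=
          restrict_eq_restrict_iff.2 fun i hi => restrict_eq_restrict_iff.1 hxy i
            (Finset.mem_compl.2 fun hij => Finset.disjoint_left.1 (hlt j m (hm j hj))
              (Finset.mem_union_right _ hij) hi)
        simp only [hh j (Finset.mem_insert_of_mem hj) x y hxy, hres]
    calc _ = ∑ x, (h x * ∏ j ∈ J, condProb P (T j) (S j) x) * condProb P (T m) (S m) x :=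
          Finset.sum_congr rfl fun x _ => by ring
      _ = _ := hstep
      _ = ∑ x, (h x * if restrict (T m) x = restrict (T m) a then 1 else 0) *
            ∏ j ∈ J, condProb P (T j) (S j) x := Finset.sum_congr rfl fun x _ => by ring
      _ = _ := hrec
      _ = _ := Finset.sum_congr rfl fun x _ => by ring

theorem subset_prevUnion (C : Fin (r + 1) → Finset ι) {i j : Fin (r + 1)} (hij : i < j) :
    C i ⊆ prevUnion C j :=
  Finset.le_sup (f := C) (by simpa using hij)

theorem disjoint_sepSet_resSet (C : Fin (r + 1) → Finset ι) (i : Fin (r + 1)) :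
    Disjoint (sepSet C i) (resSet C i) :=
  Finset.disjoint_sdiff

theorem disjoint_resSet_of_lt (C : Fin (r + 1) → Finset ι) {i j : Fin (r + 1)} (hij : i < j) :
    Disjoint (C i) (resSet C j) := by
  refine Finset.disjoint_left.2 fun k hk hkj => ?_
  have hprev := subset_prevUnion C hij hk
  simp only [resSet, sepSet, Finset.mem_sdiff, Finset.mem_inter] at hkj
  exact hkj.2 ⟨hkj.1, hprev⟩

theorem sepSet_union_resSet (C : Fin (r + 1) → Finset ι) (i : Fin (r + 1)) :
    sepSet C i ∪ resSet C i = C i :=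
  Finset.union_sdiff_of_subset Finset.inter_subset_left

theorem exists_mem_resSet {C : Fin (r + 1) → Finset ι} (i : Fin (r + 1)) {k : ι}
    (hk : k ∈ C i) : ∃ j, k ∈ resSet C j := by
  induction i using WellFoundedLT.induction with
  | ind i ih =>
    by_cases hprev : k ∈ prevUnion C i
    · obtain ⟨j, hj, hkj⟩ := Finset.mem_sup.1 hprev
      exact ih j (by simpa using hj) hkj
    · exact ⟨i, by simp [resSet, sepSet, hk, hprev]⟩

theorem resSet_subset (C : Fin (r + 1) → Finset ι) (i : Fin (r + 1)) : resSet C i ⊆ C i :=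
  Finset.sdiff_subset

theorem chainQ_nonneg {P : (∀ i, F i) → ℝ} (hP : ∀ x, 0 ≤ P x)
    (C : Fin (r + 1) → Finset ι) (x : ∀ i, F i) : 0 ≤ chainQ P C x :=
  mul_nonneg (marginal_nonneg hP _ _) <| Finset.prod_nonneg fun _ _ =>
    div_nonneg (marginal_nonneg hP _ _) (marginal_nonneg hP _ _)

theorem marginal_chainQ {P : (∀ i, F i) → ℝ} (hP : FullSupport P)
    {C : Fin (r + 1) → Finset ι} (hcov : Finset.univ.sup C = (Finset.univ : Finset ι)) :
    marginal (chainQ P C) (C 0) = marginal P (C 0) := by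
  ext s
  obtain ⟨a, rfl⟩ := exists_restrict_eq (C 0) s
  have hall : ∀ x : ∀ i, F i, restrict (C 0) x = restrict (C 0) a →
      (∀ j ≠ 0, restrict (resSet C j) x = restrict (resSet C j) a) → x = a := by
    intro x h0 hres
    ext k
    obtain ⟨i, -, hi⟩ := Finset.mem_sup.1 (hcov ▸ Finset.mem_univ k)
    obtain ⟨j, hj⟩ := exists_mem_resSet i hi
    rcases eq_or_ne j 0 with rfl | hj0
    · exact restrict_eq_restrict_iff.1 h0 k (resSet_subset C 0 hj)
    · exact restrict_eq_restrict_iff.1 (hres j hj0) k hj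
  have hsum := sum_mul_prod_condProb hP (disjoint_sepSet_resSet C)
    (fun i j hij => by
      rw [sepSet_union_resSet]
      exact disjoint_resSet_of_lt C hij)
    a (Finset.univ.filter fun j => j ≠ 0)
    (fun x => if restrict (C 0) x = restrict (C 0) a
      then marginal P (C 0) (restrict (C 0) x) else 0)
    (fun j hj x y hxy => by
      have hj0 : 0 < j := Fin.pos_iff_ne_zero.2 (Finset.mem_filter.1 hj).2
      have h0 : restrict (C 0) x = restrict (C 0) y :=
        restrict_eq_restrict_iff.2 fun i hi => restrict_eq_restrict_iff.1 hxy i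
          (Finset.mem_compl.2 (Finset.disjoint_left.1 (disjoint_resSet_of_lt C hj0) hi))
      simp only [h0])
  calc marginal (chainQ P C) (C 0) (restrict (C 0) a)
      = ∑ x, (if restrict (C 0) x = restrict (C 0) a
          then marginal P (C 0) (restrict (C 0) x) else 0) *
          ∏ j ∈ Finset.univ.filter (fun j : Fin (r + 1) => j ≠ 0),
            condProb P (resSet C j) (sepSet C j) x := by
        simp only [marginal.eq_1 (chainQ P C), chainQ, ite_mul, zero_mul]
    _ = _ := hsum
    _ = _ := by
        rw [Finset.sum_eq_single a]
        · simp
        · intro x _ hxa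
          by_contra hne
          obtain ⟨h0, hprod⟩ := mul_ne_zero_iff.1 hne
          refine hxa (hall x (by by_contra h; simp [h] at h0) fun j hj => ?_)
          by_contra h
          exact Finset.prod_ne_zero_iff.1 hprod j (by simpa using hj) (by simp [h])
        · simp

/-- In the chain junction construction (cliques `C_0, …, C_r`
covering `ι`, each separator `F_i` contained in the previous clique, and the
blocks `C_0, R_1, …, R_r` pairwise disjoint), the function `Q` is a joint
distribution on `Ω` and its marginal on `C_0` coincides with that of `P`. -/
theorem chainQ_isJoint_and_first_marginal
    (P : (∀ i, F i) → ℝ) (hP : IsJoint P) (hfull : FullSupport P)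
    (C : Fin (r + 1) → Finset ι)
    (hcov : Finset.univ.sup C = (Finset.univ : Finset ι))
    (hsep : ∀ i : Fin (r + 1), i ≠ 0 → sepSet C i ⊆ C (i - 1))
    (hdisj : ∀ i j : Fin (r + 1), i ≠ j →
      Disjoint (if i = 0 then C 0 else resSet C i)
        (if j = 0 then C 0 else resSet C j)) :
    (∀ x, 0 ≤ chainQ P C x)
      ∧ (∑ x, chainQ P C x = 1)
      ∧ marginal (chainQ P C) (C 0) = marginal P (C 0) := by
  have hmarg := marginal_chainQ hfull hcov
  refine ⟨chainQ_nonneg hP.1 C, ?_, hmarg⟩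
  rw [← sum_marginal _ (C 0), hmarg, sum_marginal, hP.2]

end CausalPre
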